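/- Let d be a positive integer. Let I be the ideal of R_q^+ generated by Φ_d(q) (the d-th cyclotomic polynomial evaluated at q, regarded as a constant polynomial in R_q^+). There exists a ring homomorphism Ψ_d : R → R_q^+ / I such that Ψ_d(B(k)) is the class of B_q(dk) modulo I for every k ∈ ℕ. (This is the quantum Frobenius map.) -/

import Mathlib

open Polynomial

noncomputable section

/-- `K = ℚ(q)`, the field of rational functions in `q` over `ℚ`. -/
abbrev K : Type := RatFunc ℚ

/-- The variable `q ∈ K`. -/
def qq : K := RatFunc.X

/-- The quantum integer `[n]_q = (q^n - 1)/(q - 1) ∈ K`. -/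
def qInt (n : ℤ) : K := (qq ^ n - 1) / (qq - 1)

/-- The quantum factorial `[n]_q! = ∏_{i=1}^n [i]_q`. -/
def qFact (n : ℕ) : K := ∏ i ∈ Finset.range n, qInt ((i : ℤ) + 1)

/-- The `q`-binomial coefficient polynomial `B_q(k) ∈ K[x]`, with `B_q(0) = 1`. -/
def Bq (k : ℕ) : K[X] :=
  C ((qq ^ (k.choose 2) * qFact k)⁻¹) * ∏ i ∈ Finset.range k, (X - C (qInt i))

/-- The subring `ℤ[q]` of `K`. -/
def Zq : Subring K := Subring.closure {qq}

/-- The ring `R_q^+` of quantum integer-valued polynomials, as a subring of `K[x]`. -/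
def RqPlus : Subring K[X] where
  carrier := {P | ∀ n : ℕ, P.eval (qInt (n : ℤ)) ∈ Zq}
  mul_mem' := by
    intro a b ha hb n
    rw [eval_mul]
    exact Zq.mul_mem (ha n) (hb n)
  one_mem' := by
    intro n
    rw [eval_one]
    exact Zq.one_mem
  add_mem' := by
    intro a b ha hb n
    rw [eval_add]
    exact Zq.add_mem (ha n) (hb n)
  zero_mem' := by
    intro n
    rw [eval_zero]
    exact Zq.zero_mem
  neg_mem' := by
    intro a ha n
    rw [eval_neg]
    exact Zq.neg_mem (ha n)

/-- The binomial coefficient polynomial `B k = x(x-1)⋯(x-k+1)/k! ∈ ℚ[x]`, with `B 0 = 1`. -/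
def B (k : ℕ) : ℚ[X] :=
  C ((k.factorial : ℚ)⁻¹) * ∏ i ∈ Finset.range k, (X - C (i : ℚ))

/-- The ring `R` of integer-valued polynomials, as a subring of `ℚ[x]`. -/
def Rring : Subring ℚ[X] where
  carrier := {P | ∀ n : ℕ, ∃ z : ℤ, P.eval (n : ℚ) = (z : ℚ)}
  mul_mem' := by
    rintro a b ha hb n
    obtain ⟨za, hza⟩ := ha n
    obtain ⟨zb, hzb⟩ := hb n
    exact ⟨za * zb, by simp [hza, hzb]⟩
  one_mem' := fun n => ⟨1, by simp⟩
  add_mem' := by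
    rintro a b ha hb n
    obtain ⟨za, hza⟩ := ha n
    obtain ⟨zb, hzb⟩ := hb n
    exact ⟨za + zb, by simp [hza, hzb]⟩
  zero_mem' := fun n => ⟨0, by simp⟩
  neg_mem' := by
    rintro a ha n
    obtain ⟨za, hza⟩ := ha n
    exact ⟨-za, by simp [hza]⟩

/-- Gaussian binomials in `ℤ[q]`, by the `q`-Pascal rule. -/
def qb : ℕ → ℕ → ℤ[X]
  | _, 0 => 1
  | 0, _ + 1 => 0
  | n + 1, k + 1 => qb n k + X ^ (k + 1) * qb n (k + 1)

lemma qb_zero_right (n : ℕ) : qb n 0 = 1 := by cases n <;> simp [qb]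

lemma qb_zero_succ (k : ℕ) : qb 0 (k + 1) = 0 := by simp [qb]

lemma qb_succ (n k : ℕ) : qb (n + 1) (k + 1) = qb n k + X ^ (k + 1) * qb n (k + 1) := by
  simp [qb]

lemma qb_eq_zero (n k : ℕ) (h : n < k) : qb n k = 0 := by
  induction n generalizing k with
  | zero => obtain ⟨k, rfl⟩ : ∃ j, k = j + 1 := ⟨k - 1, by omega⟩
            exact qb_zero_succ k
  | succ n ih =>
    obtain ⟨k, rfl⟩ : ∃ j, k = j + 1 := ⟨k - 1, by omega⟩
    rw [qb_succ, ih k (by omega), ih (k + 1) (by omega)]; simp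

lemma qb_self (n : ℕ) : qb n n = 1 := by
  induction n with
  | zero => exact qb_zero_right 0
  | succ n ih => rw [qb_succ, ih, qb_eq_zero n (n + 1) (by omega)]; simp

lemma qq_pow_ne_one (n : ℕ) (hn : n ≠ 0) : qq ^ n ≠ 1 := by
  intro h
  have h1 : algebraMap ℚ[X] K (X ^ n) = algebraMap ℚ[X] K 1 := by
    simpa [qq] using h
  have h2 := RatFunc.algebraMap_injective ℚ h1
  have h3 := congrArg natDegree h2
  simp at h3
  exact hn h3

lemma qq_ne_zero : qq ≠ 0 := RatFunc.X_ne_zero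

lemma qq_sub_one_ne : qq - 1 ≠ 0 := by
  have := qq_pow_ne_one 1 one_ne_zero
  rw [pow_one] at this
  exact sub_ne_zero.mpr this

lemma qInt_succ (n : ℕ) : qInt ((n + 1 : ℕ) : ℤ) = 1 + qq * qInt (n : ℤ) := by
  have := qq_sub_one_ne
  simp only [qInt, zpow_natCast]
  field_simp
  ring

lemma qInt_zero : qInt ((0 : ℕ) : ℤ) = 0 := by simp [qInt]

lemma qInt_succ_ne (n : ℕ) : qInt ((n + 1 : ℕ) : ℤ) ≠ 0 := by
  simp only [qInt, zpow_natCast]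
  exact div_ne_zero (sub_ne_zero.mpr (qq_pow_ne_one _ (by omega))) qq_sub_one_ne

/-- The falling product. -/
def fp (n k : ℕ) : K := ∏ i ∈ Finset.range k, (qInt (n : ℤ) - qInt (i : ℤ))

lemma fp_succ (n k : ℕ) : fp n (k + 1) = fp n k * (qInt (n : ℤ) - qInt (k : ℤ)) :=
  Finset.prod_range_succ _ _

lemma fp_succ_succ (n k : ℕ) :
    fp (n + 1) (k + 1) = qInt ((n + 1 : ℕ) : ℤ) * (qq ^ k * fp n k) := by
  unfold fp
  rw [Finset.prod_range_succ', qInt_zero, sub_zero, mul_comm]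
  congr 1
  have : ∀ i ∈ Finset.range k, (qInt ((n + 1 : ℕ) : ℤ) - qInt ((i + 1 : ℕ) : ℤ))
      = qq * (qInt (n : ℤ) - qInt (i : ℤ)) := by
    intro i _
    rw [qInt_succ, qInt_succ]; ring
  rw [Finset.prod_congr rfl this, Finset.prod_mul_distrib]
  simp

/-- The denominator. -/
def dn (k : ℕ) : K := qq ^ (k.choose 2) * qFact k

lemma dn_succ (k : ℕ) : dn (k + 1) = dn k * (qq ^ k * qInt ((k + 1 : ℕ) : ℤ)) := by
  unfold dn qFact
  rw [Finset.prod_range_succ, Nat.choose_succ_succ' k 1, Nat.choose_one_right, pow_add]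
  push_cast
  ring

lemma dn_ne (k : ℕ) : dn k ≠ 0 := by
  induction k with
  | zero => simp [dn, qFact]
  | succ k ih =>
    rw [dn_succ]
    exact mul_ne_zero ih (mul_ne_zero (pow_ne_zero _ qq_ne_zero) (qInt_succ_ne k))

lemma fp_eq (n k : ℕ) : fp n k = dn k * aeval qq (qb n k) := by
  induction n generalizing k with
  | zero =>
    cases k with
    | zero => simp [fp, dn, qFact, qb_zero_right]
    | succ k =>
      rw [qb_zero_succ, fp, Finset.prod_range_succ']
      simp
  | succ n ih =>
    cases k with
    | zero => simp [fp, dn, qFact, qb_zero_right]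
    | succ k =>
      have h1 := ih k
      have h2 := ih (k + 1)
      rw [fp_succ, dn_succ, h1] at h2
      have h3 : aeval qq (qb n k) * (qInt (n : ℤ) - qInt (k : ℤ))
          = (qq ^ k * qInt ((k + 1 : ℕ) : ℤ)) * aeval qq (qb n (k + 1)) := by
        apply mul_left_cancel₀ (dn_ne k)
        rw [← mul_assoc, h2]; ring
      rw [fp_succ_succ, dn_succ, h1, qb_succ, map_add, map_mul, map_pow, aeval_X]
      have h4 : qInt ((n + 1 : ℕ) : ℤ) = qInt ((k + 1 : ℕ) : ℤ)
          + qq * (qInt (n : ℤ) - qInt (k : ℤ)) := by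
        rw [qInt_succ, qInt_succ]; ring
      rw [h4, pow_succ]
      linear_combination (qq ^ k * dn k * qq) * h3

lemma Bq_eval (n k : ℕ) : (Bq k).eval (qInt (n : ℤ)) = aeval qq (qb n k) := by
  have h : (Bq k).eval (qInt (n : ℤ)) = (dn k)⁻¹ * fp n k := by
    simp [Bq, dn, fp, eval_prod]
  rw [h, fp_eq, inv_mul_cancel_left₀ (dn_ne k)]

lemma aeval_mem_Zq (p : ℤ[X]) : aeval qq p ∈ Zq := by
  induction p using Polynomial.induction_on' with
  | add p r hp hr => rw [map_add]; exact Zq.add_mem hp hr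
  | monomial n a =>
    rw [aeval_monomial]
    refine Zq.mul_mem ?_ (Zq.pow_mem (Subring.subset_closure rfl) n)
    simp

lemma aeval_qq_inj : Function.Injective (aeval qq : ℤ[X] →ₐ[ℤ] K) := by
  intro p r h
  have key : ∀ p : ℤ[X], aeval qq p = algebraMap ℚ[X] K (p.map (Int.castRingHom ℚ)) := by
    intro p
    induction p using Polynomial.induction_on' with
    | add p r hp hr => simp [hp, hr]
    | monomial n a =>
      rw [aeval_monomial, map_monomial, ← C_mul_X_pow_eq_monomial]
      simp [qq]
  rw [key, key] at h
  exact map_injective _ Int.cast_injective (RatFunc.algebraMap_injective ℚ h)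

/-- `ℤ[X] ≃ Zq`. -/
def zqEquiv : ℤ[X] ≃+* Zq :=
  RingEquiv.ofBijective ((aeval qq : ℤ[X] →ₐ[ℤ] K).toRingHom.codRestrict Zq aeval_mem_Zq) (by
    constructor
    · intro p r h
      exact aeval_qq_inj (congrArg Subtype.val h)
    · rintro ⟨y, hy⟩
      have hle : Zq ≤ (aeval qq : ℤ[X] →ₐ[ℤ] K).toRingHom.range := by
        unfold Zq
        rw [Subring.closure_le]
        rintro x hx
        rw [Set.mem_singleton_iff] at hx
        subst hx
        exact ⟨X, by simp⟩
      obtain ⟨p, hp⟩ := hle hy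
      exact ⟨p, Subtype.ext hp⟩)

lemma zqEquiv_coe (p : ℤ[X]) : (zqEquiv p : K) = aeval qq p := rfl

/-- Evaluation at `[n]_q`, as an integer polynomial in `q`. -/
def evq (n : ℕ) : ↥RqPlus →+* ℤ[X] :=
  zqEquiv.symm.toRingHom.comp
    (((evalRingHom (qInt (n : ℤ))).comp RqPlus.subtype).codRestrict Zq (fun P => P.2 n))

lemma evq_spec (n : ℕ) (P : ↥RqPlus) :
    aeval qq (evq n P) = (P : K[X]).eval (qInt (n : ℤ)) := by
  rw [← zqEquiv_coe]
  simp [evq]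
  rfl

lemma evq_of_eq (n k : ℕ) (P : ↥RqPlus) (h : (P : K[X]) = Bq k) : evq n P = qb n k := by
  apply aeval_qq_inj
  rw [evq_spec, h, Bq_eval]

lemma Bq_mem (k : ℕ) : Bq k ∈ RqPlus := by
  intro n
  rw [Bq_eval]
  exact aeval_mem_Zq _

/-- Evaluation at all `[n]_q`, with `q = ζ`. -/
def evz (ζ : ℂ) : ↥RqPlus →+* (ℕ → ℂ) :=
  RingHom.pi fun n => (aeval ζ : ℤ[X] →ₐ[ℤ] ℂ).toRingHom.comp (evq n)

lemma evz_apply (ζ : ℂ) (P : ↥RqPlus) (n : ℕ) : evz ζ P n = aeval ζ (evq n P) := rfl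

lemma cyc_dvd {d : ℕ} (hd : 0 < d) {ζ : ℂ} (hζ : IsPrimitiveRoot ζ d) (p : ℤ[X]) :
    aeval ζ p = 0 ↔ cyclotomic d ℤ ∣ p := by
  rw [cyclotomic_eq_minpoly hζ hd]
  exact (minpoly.isIntegrallyClosed_dvd_iff (hζ.isIntegral hd) p)

lemma ker_evz {d : ℕ} (hd : 0 < d) {ζ : ℂ} (hζ : IsPrimitiveRoot ζ d) (c : ↥RqPlus)
    (hc : (c : K[X]) = C (aeval qq (cyclotomic d ℤ))) (P : ↥RqPlus) :
    evz ζ P = 0 ↔ P ∈ Ideal.span {c} := by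
  have hcq : ∀ n, evq n c = cyclotomic d ℤ := by
    intro n
    apply aeval_qq_inj
    rw [evq_spec, hc, eval_C]
  have hne : aeval qq (cyclotomic d ℤ) ≠ 0 := by
    intro h
    exact cyclotomic_ne_zero d ℤ (aeval_qq_inj (h.trans (map_zero _).symm))
  rw [Ideal.mem_span_singleton]
  constructor
  · intro h
    have h1 : ∀ n, cyclotomic d ℤ ∣ evq n P := fun n =>
      (cyc_dvd hd hζ _).1 (by rw [← evz_apply, h]; rfl)
    choose r hr using h1
    have hQ : C (aeval qq (cyclotomic d ℤ))⁻¹ * (P : K[X]) ∈ RqPlus := by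
      intro n
      rw [eval_mul, eval_C, ← evq_spec, hr, map_mul, inv_mul_cancel_left₀ hne]
      exact aeval_mem_Zq _
    refine ⟨⟨_, hQ⟩, Subtype.ext ?_⟩
    rw [Subring.coe_mul, hc, ← mul_assoc, ← C_mul, mul_inv_cancel₀ hne]
    simp
  · rintro ⟨Q, rfl⟩
    funext n
    rw [evz_apply, map_mul, hcq]
    exact (cyc_dvd hd hζ _).2 (dvd_mul_right _ _)

lemma qb_absorb (n k : ℕ) :
    (X ^ (k + 1) - 1) * qb (n + 1) (k + 1) = (X ^ (n + 1) - 1) * qb n k := by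
  induction n generalizing k with
  | zero =>
    cases k with
    | zero => simp [qb]
    | succ k => simp [qb]
  | succ n ih =>
    cases k with
    | zero =>
      have := ih 0
      rw [qb_succ]
      simp only [qb_zero_right] at this ⊢
      linear_combination X * this
    | succ k =>
      have h1 := ih k
      have h2 := ih (k + 1)
      rw [qb_succ (n + 1), qb_succ n k] 
      rw [qb_succ n k] at h1
      linear_combination X ^ (k + 2) * h2 + X * h1

lemma qb_d {d : ℕ} {ζ : ℂ} (hζ : IsPrimitiveRoot ζ d) (j : ℕ) (h0 : 0 < j)
    (hj : j < d) : aeval ζ (qb d j) = 0 := by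
  obtain ⟨k, rfl⟩ : ∃ k, j = k + 1 := ⟨j - 1, by omega⟩
  obtain ⟨n, rfl⟩ : ∃ n, d = n + 1 := ⟨d - 1, by omega⟩
  have h := congrArg (aeval ζ) (qb_absorb n k)
  simp only [map_mul, map_sub, map_pow, aeval_X, map_one, hζ.pow_eq_one, sub_self, zero_mul] at h
  exact (mul_eq_zero.1 h).resolve_left (sub_ne_zero.2 (hζ.pow_ne_one_of_pos_of_lt (by omega) hj))

lemma qb_add_d {d : ℕ} (hd : 0 < d) {ζ : ℂ} (hζ : IsPrimitiveRoot ζ d) (n k : ℕ) :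
    aeval ζ (qb (n + d) k) = aeval ζ (qb n k) + if d ≤ k then aeval ζ (qb n (k - d)) else 0 := by
  induction n generalizing k with
  | zero =>
    rw [zero_add]
    rcases Nat.eq_zero_or_pos k with rfl | hk
    · simp [qb_zero_right, hd.ne']
    · rw [qb_eq_zero 0 k hk]
      rcases lt_trichotomy k d with h | rfl | h
      · rw [qb_d hζ k hk h]; simp [h]
      · simp [qb_self]
      · rw [qb_eq_zero d k h, qb_eq_zero 0 (k - d) (by omega)]; simp
  | succ n ih =>
    cases k with
    | zero => simp [qb_zero_right, hd.ne']
    | succ k =>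
      rw [show n + 1 + d = (n + d) + 1 by ring, qb_succ, qb_succ]
      simp only [map_add, map_mul, map_pow, aeval_X, ih]
      by_cases h : d ≤ k
      · rw [if_pos h, if_pos (by omega), if_pos (by omega),
          show k + 1 - d = (k - d) + 1 by omega, qb_succ]
        have : ζ ^ (k + 1) = ζ ^ (k - d + 1) := by
          rw [show k + 1 = (k - d + 1) + d by omega, pow_add, hζ.pow_eq_one, mul_one]
        simp only [map_add, map_mul, map_pow, aeval_X, this]
        ring
      · rw [if_neg h]
        by_cases h' : d = k + 1
        · subst h'
          simp [qb_zero_right, hζ.pow_eq_one]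
          ring
        · rw [if_neg (by omega), if_neg (by omega)]
          ring

lemma lucas {d : ℕ} (hd : 0 < d) {ζ : ℂ} (hζ : IsPrimitiveRoot ζ d) (n k : ℕ) :
    aeval ζ (qb n (d * k)) = ((n / d).choose k : ℂ) := by
  induction n using Nat.strong_induction_on generalizing k with
  | _ n ih =>
    cases k with
    | zero => simp [qb_zero_right]
    | succ k =>
      by_cases h : n < d
      · rw [Nat.div_eq_of_lt h, qb_eq_zero _ _ (by nlinarith)]
        simp
      · obtain ⟨m, rfl⟩ : ∃ m, n = m + d := ⟨n - d, by omega⟩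
        rw [qb_add_d hd hζ, if_pos (by nlinarith), ih m (by omega),
          show d * (k + 1) - d = d * k by rw [mul_add]; simp, ih m (by omega),
          Nat.add_div_right _ hd, Nat.choose_succ_succ]
        push_cast
        ring

lemma B_eval (n k : ℕ) : (B k).eval (n : ℚ) = (n.choose k : ℚ) := by
  rw [Nat.cast_choose_eq_descPochhammer_div, descPochhammer_eval_eq_prod_range]
  simp [B, eval_prod]
  ring

lemma B_mem (k : ℕ) : B k ∈ Rring := fun n => ⟨n.choose k, by rw [B_eval]; simp⟩

lemma B_natDegree (k : ℕ) : (B k).natDegree ≤ k := by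
  unfold B
  refine (natDegree_C_mul_le _ _).trans ?_
  refine (natDegree_prod_le _ _).trans ?_
  simp only [natDegree_X_sub_C]
  simp

lemma newton (P : ↥Rring) (m : ℕ) :
    ∃ Q : ↥Rring, Q ∈ AddSubgroup.closure (Set.range fun k => (⟨B k, B_mem k⟩ : ↥Rring)) ∧
      (Q : ℚ[X]).degree < m ∧ ∀ i < m, (Q : ℚ[X]).eval (i : ℚ) = (P : ℚ[X]).eval (i : ℚ) := by
  induction m with
  | zero => exact ⟨0, zero_mem _, by simp, by simp⟩
  | succ m ih =>
    obtain ⟨Q, hQ, hdeg, hev⟩ := ih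
    obtain ⟨z, hz⟩ := (P - Q).2 m
    refine ⟨Q + z • (⟨B m, B_mem m⟩ : ↥Rring),
      add_mem hQ (zsmul_mem (AddSubgroup.subset_closure (Set.mem_range_self m)) z), ?_, ?_⟩
    · have hB : (B m).degree < (m + 1 : ℕ) :=
        lt_of_le_of_lt (natDegree_le_iff_degree_le.1 (B_natDegree m))
          (by exact_mod_cast Nat.lt_succ_self m)
      have h2 : (z • B m).degree < (m + 1 : ℕ) :=
        lt_of_le_of_lt (degree_smul_le _ _) hB
      refine lt_of_le_of_lt (degree_add_le _ _) (max_lt (hdeg.trans ?_) h2)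
      exact_mod_cast Nat.lt_succ_self m
    · intro i hi
      have e : ((Q + z • (⟨B m, B_mem m⟩ : ↥Rring) : ↥Rring) : ℚ[X]).eval (i : ℚ)
          = (Q : ℚ[X]).eval (i : ℚ) + z * (i.choose m : ℚ) := by
        rw [← B_eval]
        simp
      rw [e]
      rcases Nat.lt_succ_iff_lt_or_eq.1 hi with h | rfl
      · rw [hev i h, Nat.choose_eq_zero_of_lt h]; simp
      · simp at hz
        rw [Nat.choose_self, ← hz]; simp

lemma mem_span_B (P : ↥Rring) :
    P ∈ AddSubgroup.closure (Set.range fun k => (⟨B k, B_mem k⟩ : ↥Rring)) := by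
  obtain ⟨Q, hQ, hdeg, hev⟩ := newton P ((P : ℚ[X]).natDegree + 1)
  convert hQ
  apply Subtype.ext
  refine eq_of_degrees_lt_of_eval_index_eq (Finset.range ((P : ℚ[X]).natDegree + 1))
    (v := fun i : ℕ => (i : ℚ)) (fun a _ b _ h => by simpa using h) ?_ ?_ ?_
  · rw [Finset.card_range]
    exact degree_le_natDegree.trans_lt (by exact_mod_cast Nat.lt_succ_self _)
  · rwa [Finset.card_range]
  · intro i hi
    exact (hev i (Finset.mem_range.1 hi)).symm

/-- Evaluation of an integer-valued polynomial at `⌊n/d⌋`. -/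
def evr (d : ℕ) : ↥Rring →+* (ℕ → ℂ) :=
  RingHom.pi fun n => (algebraMap ℚ ℂ).comp
    ((evalRingHom ((n / d : ℕ) : ℚ)).comp Rring.subtype)

lemma evr_apply (d : ℕ) (P : ↥Rring) (n : ℕ) :
    evr d P n = (((P : ℚ[X]).eval ((n / d : ℕ) : ℚ) : ℚ) : ℂ) := rfl

lemma evr_eq_evz {d : ℕ} (hd : 0 < d) {ζ : ℂ} (hζ : IsPrimitiveRoot ζ d) (k : ℕ)
    (P : ↥Rring) (Q : ↥RqPlus) (hP : (P : ℚ[X]) = B k) (hQ : (Q : K[X]) = Bq (d * k)) :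
    evr d P = evz ζ Q := by
  funext n
  rw [evr_apply, evz_apply, hP, B_eval, evq_of_eq n _ Q hQ, lucas hd hζ]
  simp

lemma lift_hom {A D E : Type*} [CommRing A] [CommRing D] [CommRing E] (g : A →+* E) (f : D →+* E)
    (hf : Function.Injective f) (h : ∀ a, ∃ b, f b = g a) : ∃ ψ : A →+* D, ∀ a, f (ψ a) = g a := by
  choose s hs using h
  exact ⟨{ toFun := s
           map_one' := hf (by simp [hs])
           map_mul' := fun a b => hf (by simp [hs])
           map_zero' := hf (by simp [hs])
           map_add' := fun a b => hf (by simp [hs]) }, hs⟩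

/-- The quantum Frobenius map: for every positive integer `d` there is a ring homomorphism
`Ψ_d : R → R_q^+/(Φ_d(q))` sending `B(k)` to the class of `B_q(dk)`, where the ideal is
generated by the constant polynomial `Φ_d(q)` (the `d`-th cyclotomic polynomial at `q`). -/
theorem exists_quantum_frobenius (d : ℕ) (hd : 0 < d) (c : ↥RqPlus)
    (hc : (c : K[X]) = C (Polynomial.aeval qq (Polynomial.cyclotomic d ℤ))) :
    ∃ Ψ : ↥Rring →+* (↥RqPlus ⧸ Ideal.span {c}),
      ∀ (k : ℕ) (Bk : ↥Rring) (Bqdk : ↥RqPlus),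
        (Bk : ℚ[X]) = B k → (Bqdk : K[X]) = Bq (d * k) →
          Ψ Bk = Ideal.Quotient.mk (Ideal.span {c}) Bqdk := by
  have hζ := Complex.isPrimitiveRoot_exp d hd.ne'
  set ζ : ℂ := Complex.exp (2 * Real.pi * Complex.I / d)
  have hker := ker_evz hd hζ c hc
  let f : (↥RqPlus ⧸ Ideal.span {c}) →+* (ℕ → ℂ) :=
    Ideal.Quotient.lift _ (evz ζ) (fun a ha => (hker a).2 ha)
  have hfmk : ∀ Q, f (Ideal.Quotient.mk _ Q) = evz ζ Q := fun Q => Ideal.Quotient.lift_mk _ _ _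
  have hf : Function.Injective f := by
    rw [injective_iff_map_eq_zero]
    intro a ha
    obtain ⟨Q, rfl⟩ := Ideal.Quotient.mk_surjective a
    rw [hfmk] at ha
    exact Ideal.Quotient.eq_zero_iff_mem.2 ((hker Q).1 ha)
  obtain ⟨ψ, hψ⟩ := lift_hom (evr d) f hf (by
    intro P
    induction mem_span_B P using AddSubgroup.closure_induction with
    | mem x hx =>
      obtain ⟨k, rfl⟩ := hx
      exact ⟨Ideal.Quotient.mk _ ⟨Bq (d * k), Bq_mem _⟩, by
        rw [hfmk]; exact (evr_eq_evz hd hζ k _ _ rfl rfl).symm⟩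
    | zero => exact ⟨0, by simp⟩
    | add x y _ _ hx hy =>
      obtain ⟨a, ha⟩ := hx
      obtain ⟨b, hb⟩ := hy
      exact ⟨a + b, by simp [ha, hb]⟩
    | neg x _ hx =>
      obtain ⟨a, ha⟩ := hx
      exact ⟨-a, by simp [ha]⟩)
  refine ⟨ψ, fun k Bk Bqdk h1 h2 => hf ?_⟩
  rw [hψ, hfmk]
  exact evr_eq_evz hd hζ k _ _ h1 h2
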